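/- arXiv:2303.05671 — 2 statements merged into one kernel-verified Lean document; each statement's English description precedes it below -/
import Mathlib

section
/- There exists a constant c > 0 such that for every sufficiently large n ∈ 16ℕ: Σ_{j∈ℕ(n)} ‖Δ_j((∂_x u_{0,n})²)‖_{L^∞(𝕋)} ≥ c (log n)². -/
open MeasureTheory Filter Function
open scoped ENNReal NNReal

noncomputable section

/-- The Fourier coefficient `û(ξ) = ∫_{-π}^{π} e^{-i x ξ} u(x) dx` of a `2π`-periodic
function on the torus. -/
def fCoeff (u : ℝ → ℂ) (ξ : ℤ) : ℂ :=
  ∫ x in (-Real.pi)..Real.pi, Complex.exp (-Complex.I * x * ξ) * u x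

/-- A Littlewood–Paley cutoff function: smooth, even, `0 ≤ χ ≤ 1`, `χ = 1` on `[-3/4,3/4]`,
`supp χ ⊆ (-4/3, 4/3)`, nonincreasing on `[0,∞)`. -/
structure LPCutoff where
  χ : ℝ → ℝ
  smooth : ContDiff ℝ (⊤ : ℕ∞) χ
  even : ∀ x, χ (-x) = χ x
  nonneg : ∀ x, 0 ≤ χ x
  le_one : ∀ x, χ x ≤ 1
  eq_one : ∀ x ∈ Set.Icc (-(3/4) : ℝ) (3/4 : ℝ), χ x = 1
  supp : ∀ x, χ x ≠ 0 → x ∈ Set.Ioo (-(4/3) : ℝ) (4/3 : ℝ)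
  decay : AntitoneOn χ (Set.Ici 0)

/-- `φ(ξ) = χ(ξ/2) - χ(ξ)`. -/
def LPCutoff.phi (c : LPCutoff) (x : ℝ) : ℝ := c.χ (x / 2) - c.χ x

/-- The dyadic block `Δ_j u` (for `j ≥ -1`). -/
def LPblock (c : LPCutoff) (j : ℤ) (u : ℝ → ℂ) (x : ℝ) : ℂ :=
  if j = -1 then
    (1 / (2 * Real.pi)) * ∑' ξ : ℤ, (c.χ ξ : ℂ) * fCoeff u ξ * Complex.exp (Complex.I * x * ξ)
  else
    (1 / (2 * Real.pi)) *
      ∑' ξ : ℤ, (c.phi ((2:ℝ) ^ (-j) * ξ) : ℂ) * fCoeff u ξ * Complex.exp (Complex.I * x * ξ)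

/-- The low-frequency cut-off `S_j u`. -/
def LPlow (c : LPCutoff) (j : ℤ) (u : ℝ → ℂ) (x : ℝ) : ℂ :=
  (1 / (2 * Real.pi)) *
    ∑' ξ : ℤ, (c.χ ((2:ℝ) ^ (-j) * ξ) : ℂ) * fCoeff u ξ * Complex.exp (Complex.I * x * ξ)

/-- The `L^∞(𝕋)` (sup) norm, with values in `ℝ≥0∞`. -/
def supNormE {E : Type*} [NormedAddCommGroup E] (f : ℝ → E) : ℝ≥0∞ :=
  ⨆ x : ℝ, (‖f x‖₊ : ℝ≥0∞)

/-- View a real-valued function as a complex-valued one. -/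
def toC (f : ℝ → ℝ) : ℝ → ℂ := fun x => (f x : ℂ)

/-- The `2π`-periodic square wave: `1/2` on `(0,π)`, `-1/2` on `(-π,0)`, `0` on `{-π,0,π}`. -/
def hFun (x : ℝ) : ℝ :=
  let y := x - 2 * Real.pi * ⌊(x + Real.pi) / (2 * Real.pi)⌋
  if y = 0 ∨ y = -Real.pi then 0 else if 0 < y then 1/2 else -1/2

/-- The low-frequency part `f_n = S_{n/2} h` (real-valued). -/
def fLow (c : LPCutoff) (n : ℕ) : ℝ → ℝ := fun x => (LPlow c ((n : ℤ) / 2) (toC hFun) x).re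

/-- The initial data `u_{0,n}` for the periodic Camassa–Holm equation. -/
def u0CH (c : LPCutoff) (n : ℕ) : ℝ → ℝ := fun x =>
  (2:ℝ) ^ (-(n:ℤ)) * (n:ℝ) ^ (-(2:ℝ)/5) * Real.log n * Real.cos ((2:ℝ) ^ (n:ℕ) * x) *
    (1 + (n:ℝ) ^ (-(1:ℝ)/5) * fLow c n x)

lemma tsum_sym (F : ℤ → ℂ) (M : ℕ) (hF : ∀ k : ℕ, M ≤ k → F ((k:ℤ)+1) = 0 ∧ F (-((k:ℤ)+1)) = 0) :
    ∑' ξ, F ξ = F 0 + ∑ k ∈ Finset.range M, (F ((k:ℤ)+1) + F (-((k:ℤ)+1))) := by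
  have h1 : HasSum (fun k : ℕ => F ((k:ℤ)+1)) (∑ k ∈ Finset.range M, F ((k:ℤ)+1)) := by
    apply hasSum_sum_of_ne_finset_zero
    intro k hk
    exact (hF k (by simpa using hk)).1
  have h2 : HasSum (fun k : ℕ => F (-((k:ℤ)+1))) (∑ k ∈ Finset.range M, F (-((k:ℤ)+1))) := by
    apply hasSum_sum_of_ne_finset_zero
    intro k hk
    exact (hF k (by simpa using hk)).2
  have h0 : HasSum (fun k : ℕ => F (k:ℤ)) (F 0 + ∑ k ∈ Finset.range M, F ((k:ℤ)+1)) := by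
    have := (hasSum_nat_add_iff (f := fun k : ℕ => F (k:ℤ)) 1).1 (by simpa using h1)
    simpa [add_comm] using this
  have := (HasSum.of_nat_of_neg_add_one h0 h2).tsum_eq
  rw [this, Finset.sum_add_distrib, add_assoc]

lemma phi_even (c : LPCutoff) (x : ℝ) : c.phi (-x) = c.phi x := by
  unfold LPCutoff.phi
  rw [neg_div, c.even, c.even]

lemma chi_zero (c : LPCutoff) (x : ℝ) (hx : 4/3 ≤ x) : c.χ x = 0 := by
  by_contra h
  have := c.supp x h
  linarith [this.2]

lemma phi_zero (c : LPCutoff) (x : ℝ) (hx : 8/3 ≤ x) : c.phi x = 0 := by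
  unfold LPCutoff.phi
  rw [chi_zero c _ (by linarith), chi_zero c _ (by linarith), sub_zero]

lemma phi_nonneg (c : LPCutoff) (x : ℝ) (hx : 0 ≤ x) : 0 ≤ c.phi x := by
  unfold LPCutoff.phi
  have := c.decay (a := x/2) (b := x) (by simp; linarith) (by simpa using hx) (by linarith)
  linarith

lemma phi_one (c : LPCutoff) (x : ℝ) (hx : 4/3 ≤ x) (hx' : x ≤ 3/2) : c.phi x = 1 := by
  unfold LPCutoff.phi
  rw [chi_zero c _ hx, c.eq_one (x/2) ⟨by linarith, by linarith⟩, sub_zero]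

lemma exp_m (x : ℝ) (ξ : ℤ) : Complex.exp (-Complex.I * x * ξ) =
    ((Real.cos (ξ * x) : ℝ) : ℂ) - Complex.I * ((Real.sin (ξ * x) : ℝ) : ℂ) := by
  have : -Complex.I * x * ξ = (-(ξ * x : ℂ)) * Complex.I := by ring
  rw [this, Complex.exp_mul_I, Complex.cos_neg, Complex.sin_neg]
  push_cast; ring

lemma exp_p (x : ℝ) (ξ : ℤ) : Complex.exp (Complex.I * x * ξ) =
    ((Real.cos (ξ * x) : ℝ) : ℂ) + Complex.I * ((Real.sin (ξ * x) : ℝ) : ℂ) := by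
  have : Complex.I * x * ξ = ((ξ * x : ℂ)) * Complex.I := by ring
  rw [this, Complex.exp_mul_I]
  push_cast; ring

lemma hFun_pos (x : ℝ) (h : 0 < x) (h' : x < Real.pi) : hFun x = 1/2 := by
  have hf : ⌊(x + Real.pi) / (2 * Real.pi)⌋ = 0 := by
    rw [Int.floor_eq_zero_iff]
    have := Real.pi_pos
    constructor
    · positivity
    · rw [div_lt_one (by positivity)]; linarith
  unfold hFun
  simp only [hf]
  have h1 : ¬ (x = 0 ∨ x = -Real.pi) := by
    rintro (h1 | h1) <;> linarith
  simp [h1, h]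

lemma hFun_neg (x : ℝ) (h : -Real.pi < x) (h' : x < 0) : hFun x = -1/2 := by
  have hf : ⌊(x + Real.pi) / (2 * Real.pi)⌋ = 0 := by
    rw [Int.floor_eq_zero_iff]
    have := Real.pi_pos
    constructor
    · apply div_nonneg <;> linarith
    · rw [div_lt_one (by positivity)]; linarith
  unfold hFun
  simp only [hf]
  have h1 : ¬ (x = 0 ∨ x = -Real.pi) := by
    rintro (h1 | h1) <;> linarith
  simp only [Int.cast_zero, mul_zero, sub_zero]
  rw [if_neg h1, if_neg (by linarith)]

lemma int_sin (ξ : ℤ) : ∫ x in (0:ℝ)..Real.pi, Real.sin (ξ * x) =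
    (1 - Real.cos (ξ * Real.pi)) / ξ := by
  by_cases h : ξ = 0
  · simp [h]
  · have h' : (ξ : ℝ) ≠ 0 := by exact_mod_cast h
    rw [intervalIntegral.integral_comp_mul_left (fun x => Real.sin x) h', integral_sin]
    simp
    field_simp

lemma fCoeff_h (ξ : ℤ) : fCoeff (toC hFun) ξ =
    -Complex.I * (((1 - Real.cos (ξ * Real.pi)) / ξ : ℝ) : ℂ) := by
  have hpi := Real.pi_pos
  have hc : Continuous (fun x : ℝ => Complex.exp (-Complex.I * x * ξ)) := by fun_prop
  have hc2 : Continuous (fun x : ℝ => Complex.exp (Complex.I * x * ξ)) := by fun_prop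
  have e1 : ∀ᵐ x : ℝ, x ∈ Set.uIoc 0 Real.pi →
      Complex.exp (-Complex.I * x * ξ) * toC hFun x =
        Complex.exp (-Complex.I * x * ξ) * (1/2) := by
    have : ∀ᵐ x : ℝ, x ≠ Real.pi := by simp [ae_iff]
    filter_upwards [this] with x hx hx2
    rw [Set.uIoc_of_le hpi.le] at hx2
    rw [toC, hFun_pos x hx2.1 (lt_of_le_of_ne hx2.2 hx)]
    norm_num
  have e2 : ∀ᵐ x : ℝ, x ∈ Set.uIoc (-Real.pi) 0 →
      Complex.exp (-Complex.I * x * ξ) * toC hFun x =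
        Complex.exp (-Complex.I * x * ξ) * (-1/2) := by
    have : ∀ᵐ x : ℝ, x ≠ 0 := by simp [ae_iff]
    filter_upwards [this] with x hx hx2
    rw [Set.uIoc_of_le (by linarith)] at hx2
    rw [toC, hFun_neg x hx2.1 (lt_of_le_of_ne hx2.2 hx)]
    norm_num
  have i1 : IntervalIntegrable (fun x : ℝ => Complex.exp (-Complex.I * x * ξ) * toC hFun x)
      volume 0 Real.pi := by
    refine IntervalIntegrable.congr_ae (f := fun x : ℝ => Complex.exp (-Complex.I * x * ξ) * (1/2)) ?_ ?_
    · exact (hc.mul continuous_const).intervalIntegrable _ _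
    · rw [Filter.EventuallyEq, ae_restrict_iff' measurableSet_uIoc]
      filter_upwards [e1] with x hx hx2
      exact (hx hx2).symm
  have i2 : IntervalIntegrable (fun x : ℝ => Complex.exp (-Complex.I * x * ξ) * toC hFun x)
      volume (-Real.pi) 0 := by
    refine IntervalIntegrable.congr_ae (f := fun x : ℝ => Complex.exp (-Complex.I * x * ξ) * (-1/2)) ?_ ?_
    · exact (hc.mul continuous_const).intervalIntegrable _ _
    · rw [Filter.EventuallyEq, ae_restrict_iff' measurableSet_uIoc]
      filter_upwards [e2] with x hx hx2
      exact (hx hx2).symm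
  unfold fCoeff
  rw [← intervalIntegral.integral_add_adjacent_intervals i2 i1,
    intervalIntegral.integral_congr_ae e1, intervalIntegral.integral_congr_ae e2]
  have e3 := intervalIntegral.integral_comp_neg (a := 0) (b := Real.pi)
    (fun x : ℝ => Complex.exp (-Complex.I * x * ξ) * (-1/2))
  rw [neg_zero] at e3
  rw [← e3, ← intervalIntegral.integral_add, ← int_sin, ← intervalIntegral.integral_ofReal,
    ← intervalIntegral.integral_const_mul]
  · apply intervalIntegral.integral_congr
    intro x _
    simp only [exp_m, mul_neg, Real.cos_neg, Real.sin_neg]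
    push_cast
    ring
  · exact Continuous.intervalIntegrable (by fun_prop) _ _
  · exact Continuous.intervalIntegrable (by fun_prop) _ _

/-- coefficients of the low-frequency sine series -/
def aCo (c : LPCutoff) (J : ℕ) (k : ℕ) : ℝ :=
  c.χ ((2:ℝ) ^ (-(J:ℤ)) * (k+1)) * ((1 - Real.cos ((k+1) * Real.pi)) / (k+1)) / Real.pi

lemma LPlow_h (c : LPCutoff) (J : ℕ) (x : ℝ) : (LPlow c J (toC hFun) x) =
    ((∑ k ∈ Finset.range (2*2^J), aCo c J k * Real.sin ((k+1) * x) : ℝ) : ℂ) := by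
  have hb : ∀ k : ℕ, 2*2^J ≤ k → c.χ ((2:ℝ) ^ (-(J:ℤ)) * (k+1)) = 0 := by
    intro k hk
    apply chi_zero
    have : (2:ℝ)*2^J ≤ k := by exact_mod_cast hk
    rw [zpow_neg, zpow_natCast, inv_mul_eq_div, le_div_iff₀ (by positivity)]
    have : (0:ℝ) < 2^J := by positivity
    linarith
  unfold LPlow
  rw [tsum_sym _ (2*2^J)]
  · rw [fCoeff_h 0]
    simp only [Int.cast_zero, mul_zero, div_zero, Complex.ofReal_zero, zero_mul, zero_add]
    rw [Complex.ofReal_sum, Finset.mul_sum]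
    apply Finset.sum_congr rfl
    intro k _
    rw [fCoeff_h, fCoeff_h, exp_p, exp_p]
    unfold aCo
    have hpi : (Real.pi : ℂ) ≠ 0 := by exact_mod_cast Real.pi_ne_zero
    have hk : ((k:ℂ)+1) ≠ 0 := by exact_mod_cast Nat.succ_ne_zero k
    have e1 : c.χ ((2:ℝ) ^ (-(J:ℤ)) * ((-((k:ℤ)+1) : ℤ) : ℝ)) = c.χ ((2:ℝ) ^ (-(J:ℤ)) * (k+1)) := by
      rw [← c.even]; congr 1; push_cast; ring
    rw [e1]
    push_cast
    simp only [neg_mul, Complex.cos_neg, Complex.sin_neg, div_neg]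
    field_simp
    ring_nf
    simp only [Complex.I_sq]
    ring
  · intro k hk
    have := hb k hk
    constructor
    · push_cast; rw [this]; simp
    · have e1 : c.χ ((2:ℝ) ^ (-(J:ℤ)) * ((-((k:ℤ)+1) : ℤ) : ℝ)) = c.χ ((2:ℝ) ^ (-(J:ℤ)) * (k+1)) := by
        rw [← c.even]; congr 1; push_cast; ring
      rw [e1, this]; simp

lemma fCoeff_sub (g : ℝ → ℝ) (hg : Continuous g) (ξ : ℤ) :
    fCoeff (toC g) ξ - fCoeff (toC g) (-ξ) =
      -2 * Complex.I * ((∫ x in (-Real.pi)..Real.pi, Real.sin (ξ * x) * g x : ℝ) : ℂ) := by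
  have hg2 : Continuous (toC g) := by unfold toC; fun_prop
  unfold fCoeff
  rw [← intervalIntegral.integral_sub, ← intervalIntegral.integral_ofReal,
    ← intervalIntegral.integral_const_mul]
  · apply intervalIntegral.integral_congr
    intro x _
    simp only [exp_m, toC]
    push_cast
    simp only [neg_mul, Complex.cos_neg, Complex.sin_neg]
    ring
  · exact Continuous.intervalIntegrable (by fun_prop) _ _
  · exact Continuous.intervalIntegrable (by fun_prop) _ _

lemma LPblock_sub (c : LPCutoff) (j : ℕ) (g : ℝ → ℝ) (hg : Continuous g) (x : ℝ) :
    LPblock c j (toC g) x - LPblock c j (toC g) (-x) =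
    ((∑ k ∈ Finset.range (3*2^j), (2 / Real.pi) * c.phi ((2:ℝ) ^ (-(j:ℤ)) * (k+1)) *
      (Real.sin ((k+1) * x) * ∫ y in (-Real.pi)..Real.pi, Real.sin ((k+1) * y) * g y) : ℝ) : ℂ) := by
  have hb : ∀ k : ℕ, 3*2^j ≤ k → c.phi ((2:ℝ) ^ (-(j:ℤ)) * (k+1)) = 0 := by
    intro k hk
    apply phi_zero
    have : (3:ℝ)*2^j ≤ k := by exact_mod_cast hk
    rw [zpow_neg, zpow_natCast, inv_mul_eq_div, le_div_iff₀ (by positivity)]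
    have : (0:ℝ) < 2^j := by positivity
    linarith
  have he : ∀ k : ℕ, c.phi ((2:ℝ) ^ (-(j:ℤ)) * ((-((k:ℤ)+1) : ℤ) : ℝ)) = c.phi ((2:ℝ) ^ (-(j:ℤ)) * (k+1)) := by
    intro k
    rw [← phi_even]; congr 1; push_cast; ring
  have key : ∀ x : ℝ, ∀ k : ℕ, 3*2^j ≤ k →
    (c.phi ((2:ℝ) ^ (-(j:ℤ)) * (((k:ℤ)+1 : ℤ) : ℝ)) : ℂ) * fCoeff (toC g) ((k:ℤ)+1) * Complex.exp (Complex.I * x * (((k:ℤ)+1 : ℤ) : ℂ)) = 0 ∧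
    (c.phi ((2:ℝ) ^ (-(j:ℤ)) * ((-((k:ℤ)+1) : ℤ) : ℝ)) : ℂ) * fCoeff (toC g) (-((k:ℤ)+1)) * Complex.exp (Complex.I * x * ((-((k:ℤ)+1) : ℤ) : ℂ)) = 0 := by
    intro x k hk
    constructor
    · push_cast; rw [hb k hk]; simp
    · rw [he, hb k hk]; simp
  unfold LPblock
  have hj : ¬ ((j:ℤ) = -1) := by omega
  rw [if_neg hj, if_neg hj, tsum_sym _ (3*2^j) (key x), tsum_sym _ (3*2^j) (key (-x)), ← mul_sub,
    Complex.ofReal_sum]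
  simp only [Int.cast_zero, mul_zero, Complex.exp_zero, add_sub_add_left_eq_sub]
  rw [← Finset.sum_sub_distrib, Finset.mul_sum]
  apply Finset.sum_congr rfl
  intro k _
  rw [he]
  have hs := fCoeff_sub g hg ((k:ℤ)+1)
  have hpi : (Real.pi : ℂ) ≠ 0 := by exact_mod_cast Real.pi_ne_zero
  have hf : fCoeff (toC g) ((k:ℤ)+1) = fCoeff (toC g) (-((k:ℤ)+1)) + -2 * Complex.I * ((∫ x in (-Real.pi)..Real.pi, Real.sin ((((k:ℤ)+1 : ℤ):ℝ) * x) * g x : ℝ) : ℂ) := by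
    rw [← hs]; ring
  rw [hf]
  simp only [exp_p]
  push_cast
  generalize (∫ y in (-Real.pi)..Real.pi, Real.sin (((k:ℝ)+1) * y) * g y) = B
  simp only [neg_mul, mul_neg, Complex.cos_neg, Complex.sin_neg]
  field_simp
  ring_nf
  simp only [Complex.I_sq]
  ring

def HI (F : ℝ → ℝ) (v : ℝ) : Prop :=
  Continuous F ∧ ∫ x in (-Real.pi)..Real.pi, F x = v

lemma HI.add {F G : ℝ → ℝ} {v w : ℝ} (h : HI F v) (h' : HI G w) :
    HI (fun x => F x + G x) (v + w) := by
  refine ⟨h.1.add h'.1, ?_⟩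
  rw [intervalIntegral.integral_add (h.1.intervalIntegrable _ _) (h'.1.intervalIntegrable _ _),
    h.2, h'.2]

lemma HI.cmul {F : ℝ → ℝ} {v : ℝ} (a : ℝ) (h : HI F v) :
    HI (fun x => a * F x) (a * v) := by
  refine ⟨continuous_const.mul h.1, ?_⟩
  rw [intervalIntegral.integral_const_mul, h.2]

lemma HI.sum {ι : Type} (s : Finset ι) {F : ι → ℝ → ℝ} {v : ι → ℝ} (h : ∀ i, HI (F i) (v i)) :
    HI (fun x => ∑ i ∈ s, F i x) (∑ i ∈ s, v i) := by
  refine ⟨continuous_finsetSum _ (fun i _ => (h i).1), ?_⟩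
  rw [intervalIntegral.integral_finsetSum (fun i _ => (h i).1.intervalIntegrable _ _)]
  exact Finset.sum_congr rfl (fun i _ => (h i).2)

lemma HI_cos (m : ℤ) : HI (fun x => Real.cos (m * x)) (if m = 0 then 2 * Real.pi else 0) := by
  refine ⟨by fun_prop, ?_⟩
  split_ifs with h
  · simp [h]; ring
  · have h' : (m : ℝ) ≠ 0 := by exact_mod_cast h
    rw [intervalIntegral.integral_comp_mul_left (fun x => Real.cos x) h', integral_cos]
    simp [Real.sin_int_mul_pi]

lemma HI_cos0 (m : ℤ) (h : m ≠ 0) : HI (fun x => Real.cos (m * x)) 0 := by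
  have := HI_cos m
  rwa [if_neg h] at this

lemma HI_odd (F : ℝ → ℝ) (hc : Continuous F) (h : ∀ x, F (-x) = - F x) : HI F 0 := by
  refine ⟨hc, ?_⟩
  have := intervalIntegral.integral_comp_neg (a := -Real.pi) (b := Real.pi) F
  simp only [h, neg_neg, intervalIntegral.integral_neg] at this
  linarith

lemma HI_T (N ξ k : ℕ) (hk : 0 < k) (hξ : 0 < ξ) (hN : ξ + k < 2 * N) :
    HI (fun x => Real.sin (ξ * x) * (2 * N * Real.sin (N * x) ^ 2 * Real.sin (k * x)
      - 2 * Real.sin (N * x) * Real.cos (N * x) * (k * Real.cos (k * x))))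
      (if ξ = k then N * Real.pi else 0) := by
  have h := ((((((((((HI_cos ((ξ:ℤ) - k)).cmul ((N:ℝ)/2)).add
    ((HI_cos0 ((ξ:ℤ) + k) (by omega)).cmul (-(N:ℝ)/2))).add
    ((HI_cos0 ((ξ:ℤ) - k + 2 * N) (by omega)).cmul (-(N:ℝ)/4))).add
    ((HI_cos0 ((ξ:ℤ) - k - 2 * N) (by omega)).cmul (-(N:ℝ)/4))).add
    ((HI_cos0 ((ξ:ℤ) + k + 2 * N) (by omega)).cmul ((N:ℝ)/4))).add
    ((HI_cos0 ((ξ:ℤ) + k - 2 * N) (by omega)).cmul ((N:ℝ)/4))).add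
    ((HI_cos0 ((ξ:ℤ) + k - 2 * N) (by omega)).cmul (-(k:ℝ)/4))).add
    ((HI_cos0 ((ξ:ℤ) - k - 2 * N) (by omega)).cmul (-(k:ℝ)/4))).add
    ((HI_cos0 ((ξ:ℤ) + k + 2 * N) (by omega)).cmul ((k:ℝ)/4))).add
    ((HI_cos0 ((ξ:ℤ) - k + 2 * N) (by omega)).cmul ((k:ℝ)/4))
  convert h using 1
  · funext x
    push_cast
    simp only [add_mul, sub_mul, Real.cos_add, Real.cos_sub, Real.sin_add, Real.sin_sub]
    have e1 : 2 * (N:ℝ) * x = 2 * (N * x) := by ring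
    rw [e1, Real.cos_two_mul, Real.sin_two_mul]
    have e2 := Real.sin_sq (N * x)
    rw [e2]
    ring
  · by_cases hx : ξ = k
    · have : (ξ:ℤ) - k = 0 := by omega
      rw [if_pos hx, if_pos this]; ring
    · have : ¬ (ξ:ℤ) - k = 0 := by omega
      rw [if_neg hx, if_neg this]; ring

lemma HI_main (M m N : ℕ) (a : ℕ → ℝ) (P ε : ℝ) (hm : m < M) (hN : M + m + 1 < 2 * N) :
    HI (fun x => Real.sin ((m+1) * x) * (P * (-(N:ℝ) * Real.sin (N * x) *
        (1 + ε * ∑ k ∈ Finset.range M, a k * Real.sin ((k+1) * x)) +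
      Real.cos (N * x) * (ε * ∑ k ∈ Finset.range M, a k * ((k+1) * Real.cos ((k+1) * x))))) ^ 2)
      (P ^ 2 * N ^ 2 * ε * Real.pi * a m) := by
  set f : ℝ → ℝ := fun x => ∑ k ∈ Finset.range M, a k * Real.sin ((k+1) * x) with hf
  set f' : ℝ → ℝ := fun x => ∑ k ∈ Finset.range M, a k * ((k+1) * Real.cos ((k+1) * x)) with hf'
  have fodd : ∀ x, f (-x) = - f x := by
    intro x; simp [hf, ← Finset.sum_neg_distrib]
  have f'even : ∀ x, f' (-x) = f' x := by
    intro x; simp [hf']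
  have fc : Continuous f := by fun_prop
  have fc' : Continuous f' := by fun_prop
  have h1 : HI (fun x => Real.sin ((m+1) * x) * (P ^ 2 * (N ^ 2 * Real.sin (N * x) ^ 2 *
      (1 + ε ^ 2 * f x ^ 2) - 2 * N * ε ^ 2 * Real.sin (N * x) * Real.cos (N * x) * f x * f' x
      + Real.cos (N * x) ^ 2 * ε ^ 2 * f' x ^ 2))) 0 := by
    apply HI_odd
    · fun_prop
    · intro x
      simp only [fodd, f'even, mul_neg, Real.sin_neg, Real.cos_neg]
      ring
  have h2 : HI (fun x => ∑ k ∈ Finset.range M, (if k < M then P ^ 2 * N * ε * a k else 0) * (Real.sin ((m+1) * x) * (2 * N * Real.sin (N * x) ^ 2 * Real.sin ((k + 1) * x)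
      - 2 * Real.sin (N * x) * Real.cos (N * x) * ((k + 1) * Real.cos ((k + 1) * x)))))
      (∑ k ∈ Finset.range M, (if k < M then P ^ 2 * N * ε * a k else 0) * (if m = k then N * Real.pi else 0)) := by
    apply HI.sum
    intro k
    by_cases hk : k < M
    · have := (HI_T N (m+1) (k+1) (by omega) (by omega) (by omega)).cmul (P ^ 2 * N * ε * a k)
      simp only [hk, if_true]
      push_cast at this
      simpa using this
    · simp only [hk, if_false, zero_mul]
      exact ⟨by fun_prop, by simp⟩
  convert h1.add h2 using 1
  · funext x
    have : (∑ k ∈ Finset.range M, (if k < M then P ^ 2 * N * ε * a k else 0) * (Real.sin ((m+1) * x) * (2 * N * Real.sin (N * x) ^ 2 * Real.sin ((k + 1) * x)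
      - 2 * Real.sin (N * x) * Real.cos (N * x) * ((k + 1) * Real.cos ((k + 1) * x)))))
      = P ^ 2 * N * ε * Real.sin ((m+1) * x) * (2 * N * Real.sin (N * x) ^ 2 * f x - 2 * Real.sin (N * x) * Real.cos (N * x) * f' x) := by
      simp only [hf, hf', Finset.mul_sum, ← Finset.sum_sub_distrib]
      apply Finset.sum_congr rfl
      intro k hk
      rw [if_pos (by simpa using hk)]
      ring
    rw [this]
    ring
  · rw [Finset.sum_eq_single m]
    · simp [hm]; ring
    · intro b _ hb
      simp [hb.symm]
    · intro h; simp at h; omega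

lemma fLow_eq (c : LPCutoff) (n : ℕ) : fLow c n = fun x =>
    ∑ k ∈ Finset.range (2*2^(n/2)), aCo c (n/2) k * Real.sin ((k+1) * x) := by
  funext x
  unfold fLow
  have : (n:ℤ)/2 = ((n/2 : ℕ) : ℤ) := by norm_cast
  rw [this, LPlow_h, Complex.ofReal_re]

lemma deriv_u0 (c : LPCutoff) (n : ℕ) (x : ℝ) : deriv (u0CH c n) x =
    ((2:ℝ) ^ (-(n:ℤ)) * (n:ℝ) ^ (-(2:ℝ)/5) * Real.log n) *
    (-((2^n : ℕ):ℝ) * Real.sin (((2^n : ℕ):ℝ) * x) *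
        (1 + (n:ℝ) ^ (-(1:ℝ)/5) * ∑ k ∈ Finset.range (2*2^(n/2)), aCo c (n/2) k * Real.sin ((k+1) * x)) +
      Real.cos (((2^n : ℕ):ℝ) * x) * ((n:ℝ) ^ (-(1:ℝ)/5) * ∑ k ∈ Finset.range (2*2^(n/2)), aCo c (n/2) k * ((k+1) * Real.cos ((k+1) * x)))) := by
  apply HasDerivAt.deriv
  unfold u0CH
  rw [fLow_eq]
  have h1 : HasDerivAt (fun x : ℝ => ∑ k ∈ Finset.range (2*2^(n/2)), aCo c (n/2) k * Real.sin ((k+1) * x))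
      (∑ k ∈ Finset.range (2*2^(n/2)), aCo c (n/2) k * ((k+1) * Real.cos ((k+1) * x))) x := by
    apply HasDerivAt.fun_sum
    intro k _
    apply HasDerivAt.const_mul
    exact (((hasDerivAt_id' x).const_mul ((k:ℝ)+1)).sin).congr_deriv (by ring)
  have h2 : HasDerivAt (fun x : ℝ => Real.cos ((2:ℝ)^n * x)) (-Real.sin ((2:ℝ)^n * x) * 2^n) x := by
    exact (((hasDerivAt_id' x).const_mul ((2:ℝ)^n)).cos).congr_deriv (by ring)
  have h3 := (h2.const_mul ((2:ℝ) ^ (-(n:ℤ)) * (n:ℝ) ^ (-(2:ℝ)/5) * Real.log n)).mul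
    ((h1.const_mul ((n:ℝ) ^ (-(1:ℝ)/5))).const_add 1)
  refine h3.congr_deriv ?_
  push_cast
  ring

lemma B_val (c : LPCutoff) (n m : ℕ) (hn : 0 < n) (hm : m < 2*2^(n/2)) (hN : 2*2^(n/2) + m + 1 < 2 * 2^n) :
    Continuous (fun x => (deriv (u0CH c n) x) ^ 2) ∧
    ∫ y in (-Real.pi)..Real.pi, Real.sin ((m+1) * y) * (deriv (u0CH c n) y) ^ 2 =
      (Real.log n)^2 / n * (c.χ ((2:ℝ) ^ (-((n/2 : ℕ):ℤ)) * (m+1)) * ((1 - Real.cos ((m+1) * Real.pi)) / (m+1))) := by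
  have hn' : (0:ℝ) < n := by exact_mod_cast hn
  simp only [deriv_u0]
  refine ⟨by fun_prop, ?_⟩
  rw [(HI_main (2*2^(n/2)) m (2^n) (aCo c (n/2)) _ _ hm hN).2]
  have e1 : ((n:ℝ) ^ (-(2:ℝ)/5))^2 * (n:ℝ) ^ (-(1:ℝ)/5) = 1 / n := by
    rw [← Real.rpow_natCast, ← Real.rpow_mul hn'.le, ← Real.rpow_add hn', one_div, ← Real.rpow_neg_one]
    norm_num
  have e2 : (2:ℝ) ^ (-(n:ℤ)) * ((2^n : ℕ) : ℝ) = 1 := by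
    rw [zpow_neg, zpow_natCast]; push_cast; field_simp
  have : Real.pi ≠ 0 := Real.pi_ne_zero
  calc _ = ((2:ℝ) ^ (-(n:ℤ)) * ((2^n : ℕ) : ℝ))^2 * (((n:ℝ) ^ (-(2:ℝ)/5))^2 * (n:ℝ) ^ (-(1:ℝ)/5)) * (Real.log n)^2 * (Real.pi * aCo c (n/2) m) := by ring
    _ = _ := by
      rw [e1, e2, aCo, mul_div_cancel₀ _ this]; ring

lemma block_lower (c : LPCutoff) (t j : ℕ) (ht : 2 ≤ t) (hj : 2 * t ≤ j) (hj' : j ≤ 4 * t) :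
    ENNReal.ofReal ((Real.log (16*t : ℕ))^2 / (16*t : ℕ) / (4 * Real.pi^2)) ≤
      supNormE (LPblock c (j : ℤ) (toC fun x => (deriv (u0CH c (16*t)) x) ^ 2)) := by
  set n := 16 * t with hn
  set q := 2^(4*t) with hq
  have hq16 : 16 ≤ q := by
    calc 16 = 2^4 := by norm_num
      _ ≤ 2^(4*t) := Nat.pow_le_pow_right (by norm_num) (by omega)
  have hn2 : 2^(n/2) = q^2 := by
    rw [hq, ← pow_mul]; congr 1; omega
  have hn1 : 2^n = q^4 := by
    rw [hq, ← pow_mul]; congr 1; omega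
  have hjq : 2^j ≤ q := Nat.pow_le_pow_right (by norm_num) hj'
  have hM : ∀ m, m < 3*2^j → m < 2*2^(n/2) := by
    intro m hm; rw [hn2]; nlinarith
  have hN : ∀ m, m < 3*2^j → 2*2^(n/2) + m + 1 < 2*2^n := by
    intro m hm; rw [hn2, hn1]
    have : q^4 = q^2*q^2 := by ring
    nlinarith [sq_nonneg q, mul_le_mul hq16 hq16 (by norm_num) (by positivity)]
  have hB := fun m hm => B_val c n m (by omega) (hM m hm) (hN m hm)
  have hcont := (hB 0 (by positivity)).1
  set g : ℝ → ℝ := fun x => (deriv (u0CH c n) x) ^ 2 with hg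
  set L := (Real.log n)^2 / n with hL
  have hL0 : 0 ≤ L := by positivity
  set x : ℝ := (2:ℝ) ^ (-(j:ℤ)) with hx
  have hx0 : 0 < x := by positivity
  have hpi := Real.pi_gt_three
  obtain ⟨i, rfl⟩ : ∃ i, j = i + 4 := ⟨j - 4, by omega⟩
  have hxi : x * 2^i = 1/16 := by
    rw [hx, zpow_neg, zpow_natCast, pow_add]; field_simp; norm_num
  have hsub := LPblock_sub c (i+4) g hcont x
  set S : ℝ := ∑ k ∈ Finset.range (3*2^(i+4)), (2 / Real.pi) * c.phi ((2:ℝ) ^ (-((i+4:ℕ):ℤ)) * (k+1)) *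
      (Real.sin ((k+1) * x) * ∫ y in (-Real.pi)..Real.pi, Real.sin ((k+1) * y) * g y) with hS
  have hSlow : L / (2 * Real.pi^2) ≤ S := by
    have himg : (Finset.range (2^i)).image (fun m => 22*2^i + 2*m) ⊆ Finset.range (3*2^(i+4)) := by
      intro k hk
      simp only [Finset.mem_image, Finset.mem_range] at hk ⊢
      obtain ⟨m, hm, rfl⟩ := hk
      rw [pow_add]; omega
    have hnn : ∀ k ∈ Finset.range (3*2^(i+4)), k ∉ (Finset.range (2^i)).image (fun m => 22*2^i + 2*m) →
        0 ≤ (2 / Real.pi) * c.phi ((2:ℝ) ^ (-((i+4:ℕ):ℤ)) * (k+1)) *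
      (Real.sin ((k+1) * x) * ∫ y in (-Real.pi)..Real.pi, Real.sin ((k+1) * y) * g y) := by
      intro k hk _
      rw [(hB k (by simpa using hk)).2, ← hx]
      by_cases h : 8/3 ≤ x * (k+1)
      · rw [phi_zero c _ h]; simp
      · push Not at h
        have hs : 0 ≤ Real.sin ((k+1) * x) :=
          Real.sin_nonneg_of_nonneg_of_le_pi (by positivity) (by linarith)
        have h1 := phi_nonneg c (x * (k+1)) (by positivity)
        have h2 := c.nonneg ((2:ℝ) ^ (-((n/2 : ℕ):ℤ)) * (k+1))
        have h3 : 0 ≤ 1 - Real.cos ((k+1) * Real.pi) := by linarith [Real.cos_le_one ((k+1) * Real.pi)]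
        positivity
    refine le_trans ?_ (Finset.sum_le_sum_of_subset_of_nonneg himg hnn)
    rw [Finset.sum_image (by intro a _ b _ h; simp at h; exact h)]
    have hterm : ∀ m ∈ Finset.range (2^i), 8 / Real.pi^2 * L * x ≤ (2 / Real.pi) * c.phi ((2:ℝ) ^ (-((i+4:ℕ):ℤ)) * (((22*2^i + 2*m : ℕ):ℝ)+1)) *
      (Real.sin ((((22*2^i + 2*m : ℕ):ℝ)+1) * x) * ∫ y in (-Real.pi)..Real.pi, Real.sin ((((22*2^i + 2*m : ℕ):ℝ)+1) * y) * g y) := by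
      intro m hm
      have hm' : m < 2^i := by simpa using hm
      have hk : 22*2^i + 2*m < 3 * 2^(i+4) := by rw [pow_add]; omega
      rw [(hB _ hk).2, ← hx]
      have hcos : Real.cos ((((22*2^i + 2*m : ℕ):ℝ)+1) * Real.pi) = -1 := by
        have : (((22*2^i + 2*m : ℕ):ℝ)+1) * Real.pi = Real.pi + ((11*2^i+m : ℕ):ℝ) * (2 * Real.pi) := by
          push_cast; ring
        rw [this, Real.cos_add_nat_mul_two_pi, Real.cos_pi]
      rw [hcos]
      have hlow : (22:ℝ)*2^i ≤ ((22*2^i + 2*m : ℕ):ℝ)+1 := by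
        push_cast; linarith [(Nat.cast_nonneg m : (0:ℝ) ≤ m)]
      have hup : ((22*2^i + 2*m : ℕ):ℝ)+1 ≤ 24*2^i := by
        have : 22*2^i + 2*m + 1 ≤ 24*2^i := by omega
        exact_mod_cast this
      have hupq : ((22*2^i + 2*m : ℕ):ℝ)+1 ≤ 3/2 * q := by
        have : 16 * 2^i ≤ q := by rw [pow_add] at hjq; omega
        have : (16:ℝ) * 2^i ≤ q := by exact_mod_cast this
        linarith
      generalize (((22*2^i + 2*m : ℕ):ℝ)+1) = K at *
      have hK0 : 0 < K := lt_of_lt_of_le (by positivity) hlow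
      have h1 : 4/3 ≤ x * K := by nlinarith
      have h2 : x * K ≤ 3/2 := by nlinarith
      have hchi : c.χ ((2:ℝ) ^ (-((n/2 : ℕ):ℤ)) * K) = 1 := by
        apply c.eq_one
        have hq' : (2:ℝ)^(n/2) = (q:ℝ)^2 := by exact_mod_cast hn2
        have : (16:ℝ) ≤ q := by exact_mod_cast hq16
        rw [zpow_neg, zpow_natCast, hq', inv_mul_eq_div]
        constructor
        · have : 0 ≤ K / (q:ℝ)^2 := by positivity
          linarith
        · rw [div_le_iff₀ (by positivity)]
          nlinarith
      rw [hchi, phi_one c _ h1 h2]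
      have hsin : 2 / Real.pi * (K * x) ≤ Real.sin (K * x) :=
        Real.mul_le_sin (by positivity) (by linarith)
      calc 8 / Real.pi^2 * L * x = 2 / Real.pi * 1 * ((2 / Real.pi * (K * x)) * (L * (1 * ((1 - -1)/K)))) := by
            field_simp; ring
        _ ≤ _ := by gcongr
    have := Finset.sum_le_sum hterm
    refine le_trans ?_ this
    rw [Finset.sum_const, Finset.card_range, nsmul_eq_mul]
    push_cast
    have : (2:ℝ)^i * (8 / Real.pi^2 * L * x) = 8 / Real.pi^2 * L * (x * 2^i) := by ring
    rw [this, hxi]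
    apply le_of_eq; field_simp; ring
  have hS0 : S ≤ ‖LPblock c ((i+4 : ℕ):ℤ) (toC g) x‖ + ‖LPblock c ((i+4 : ℕ):ℤ) (toC g) (-x)‖ := by
    refine le_trans ?_ (norm_sub_le _ _)
    rw [hsub, Complex.norm_real]
    exact le_abs_self S
  have hex : ∃ y, L / (4 * Real.pi^2) ≤ ‖LPblock c ((i+4 : ℕ):ℤ) (toC g) y‖ := by
    by_contra hcon
    push Not at hcon
    have a1 := hcon x
    have a2 := hcon (-x)
    have : L / (2 * Real.pi^2) = L / (4 * Real.pi^2) + L / (4 * Real.pi^2) := by field_simp; ring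
    linarith
  obtain ⟨y, hy⟩ := hex
  unfold supNormE
  refine le_trans ?_ (le_iSup _ y)
  rw [← enorm_eq_nnnorm, ← ofReal_norm]
  exact ENNReal.ofReal_le_ofReal hy

/-- `Σ_{j ∈ ℕ(n)} ‖Δ_j((∂_x u_{0,n})²)‖_{L^∞} ≥ c (log n)²` for all sufficiently large
`n ∈ 16ℕ`. -/
theorem u0CH_deriv_sq_lower_bound (c : LPCutoff) :
    ∃ c₀ : ℝ, 0 < c₀ ∧ ∃ N : ℕ, ∀ n : ℕ, 16 ∣ n → N ≤ n →
      ENNReal.ofReal (c₀ * (Real.log n) ^ 2) ≤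
        ∑ j ∈ Finset.Icc (n / 8) (n / 4),
          supNormE (LPblock c (j : ℤ) (toC fun x => (deriv (u0CH c n) x) ^ 2)) := by
  refine ⟨1 / (32 * Real.pi^2), by positivity, 32, ?_⟩
  rintro n ⟨t, rfl⟩ hN
  have ht : 2 ≤ t := by omega
  have h8 : 16 * t / 8 = 2 * t := by omega
  have h4 : 16 * t / 4 = 4 * t := by omega
  rw [h8, h4]
  refine le_trans ?_ (Finset.sum_le_sum (fun j hj => block_lower c t j ht
    (Finset.mem_Icc.1 hj).1 (Finset.mem_Icc.1 hj).2))
  rw [Finset.sum_const, nsmul_eq_mul, ← ENNReal.ofReal_natCast, ← ENNReal.ofReal_mul (by positivity)]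
  apply ENNReal.ofReal_le_ofReal
  have hc : (2 * t : ℝ) ≤ ((Finset.Icc (2*t) (4*t)).card : ℝ) := by
    have : 2 * t ≤ (Finset.Icc (2*t) (4*t)).card := by rw [Nat.card_Icc]; omega
    exact_mod_cast this
  have ht0 : (0:ℝ) < t := by exact_mod_cast (by omega : 0 < t)
  have hpi := Real.pi_pos
  calc _ = (2 * t : ℝ) * ((Real.log (16*t : ℕ))^2 / (16*t : ℕ) / (4 * Real.pi^2)) := by
        push_cast; field_simp; ring
    _ ≤ _ := by gcongr
end
end

section
/- There exists a constant C̃ > 0 such that for every T > 0, every smooth solution u of the periodic Camassa–Holm equation on [0,T] × 𝕋, and every t ∈ [0,T]: ‖u(t,·)‖_{L^∞(𝕋)} + ‖∂_x u(t,·)‖_{L^∞(𝕋)} ≤ (‖u(0,·)‖_{L^∞(𝕋)} + ‖∂_x u(0,·)‖_{L^∞(𝕋)}) · exp( C̃ ∫_0^t ‖∂_x u(τ,·)‖_{L^∞(𝕋)} dτ ). -/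
open MeasureTheory Filter Function
open scoped ENNReal NNReal

noncomputable section

/-- `u` is a smooth, spatially `2π`-periodic solution of the periodic Camassa–Holm equation
`∂_t u - ∂_t ∂_x² u + 3 u ∂_x u = 2 ∂_x u ∂_x² u + u ∂_x³ u` on `[0,T] × 𝕋`. -/
def IsCHSolution (T : ℝ) (u : ℝ → ℝ → ℝ) : Prop :=
  ContDiff ℝ (⊤ : ℕ∞) (Function.uncurry u) ∧
  (∀ t, Function.Periodic (u t) (2 * Real.pi)) ∧
  ∀ t ∈ Set.Icc (0:ℝ) T, ∀ x : ℝ,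
    deriv (fun s => u s x) t - deriv (fun s => deriv (deriv (u s)) x) t
        + 3 * u t x * deriv (u t) x
      = 2 * deriv (u t) x * deriv (deriv (u t)) x + u t x * deriv (deriv (deriv (u t))) x

lemma CHaux_attain (g : ℝ → ℝ) (hc : Continuous g) (hp : Function.Periodic g (2 * Real.pi)) :
    ∃ x0, ∀ x, g x ≤ g x0 := by
  have hpi : (0:ℝ) < 2 * Real.pi := by positivity
  obtain ⟨x0, -, h0⟩ := (isCompact_Icc (a := (0:ℝ)) (b := 0 + 2 * Real.pi)).exists_isMaxOn
    (Set.nonempty_Icc.2 (by linarith)) hc.continuousOn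
  refine ⟨x0, fun x => ?_⟩
  have : g x ∈ g '' Set.Icc 0 (0 + 2 * Real.pi) := by
    rw [hp.image_Icc hpi]; exact Set.mem_range_self x
  obtain ⟨y, hy, e⟩ := this
  rw [← e]; exact h0 hy

lemma CHaux_max (k k' : ℝ → ℝ) (s B : ℝ) (hk : ∀ x, HasDerivAt k (k' x) x)
    (hp : Function.Periodic k (2 * Real.pi)) (h : ∀ x, k x + s * k' x ≤ B) (x : ℝ) : k x ≤ B := by
  obtain ⟨x0, h0⟩ := CHaux_attain k
    (continuous_iff_continuousAt.2 fun x => (hk x).continuousAt) hp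
  have hl : IsLocalMax k x0 := Filter.Eventually.of_forall h0
  have := hl.hasDerivAt_eq_zero (hk x0)
  have h1 := h x0
  rw [this] at h1
  linarith [h0 x]

lemma CHaux_max_abs (k k' : ℝ → ℝ) (s B : ℝ) (hk : ∀ x, HasDerivAt k (k' x) x)
    (hp : Function.Periodic k (2 * Real.pi)) (h : ∀ x, |k x + s * k' x| ≤ B) (x : ℝ) :
    |k x| ≤ B := by
  rw [abs_le']
  refine ⟨CHaux_max k k' s B hk hp (fun x => (abs_le.1 (h x)).2) x, ?_⟩
  refine CHaux_max (fun x => - k x) (fun x => - k' x) s B (fun x => (hk x).neg)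
    (fun x => by simp [hp x]) (fun x => ?_) x
  have := (abs_le.1 (h x)).1
  linarith

lemma CHaux_key (u u1 u2 u3 a a1 a2 : ℝ → ℝ) (U V : ℝ)
    (hu : ∀ x, HasDerivAt u (u1 x) x) (hu1 : ∀ x, HasDerivAt u1 (u2 x) x)
    (hu2 : ∀ x, HasDerivAt u2 (u3 x) x)
    (ha : ∀ x, HasDerivAt a (a1 x) x) (ha1 : ∀ x, HasDerivAt a1 (a2 x) x)
    (pu : Function.Periodic u (2 * Real.pi)) (pu1 : Function.Periodic u1 (2 * Real.pi))
    (pu2 : Function.Periodic u2 (2 * Real.pi)) (pa : Function.Periodic a (2 * Real.pi))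
    (pa1 : Function.Periodic a1 (2 * Real.pi))
    (he : ∀ x, a x - a2 x + 3 * u x * u1 x = 2 * u1 x * u2 x + u x * u3 x)
    (hU : ∀ x, |u x| ≤ U) (hV : ∀ x, |u1 x| ≤ V) (x : ℝ) :
    |a x + u x * u1 x| ≤ V * (2 * U + V) ∧
    |a1 x + u1 x ^ 2 + u x * u2 x| ≤ V * (2 * U + V) := by
  have hV0 : 0 ≤ V := (abs_nonneg _).trans (hV 0)
  have hb1 : ∀ x, |u x * u1 x| ≤ U * V := fun x => by
    rw [abs_mul]; exact mul_le_mul (hU x) (hV x) (abs_nonneg _) ((abs_nonneg _).trans (hU 0))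
  have hb2 : ∀ x, u1 x ^ 2 ≤ V ^ 2 := fun x => by
    rw [← sq_abs]; exact pow_le_pow_left₀ (abs_nonneg _) (hV x) 2
  have hf : ∀ x, HasDerivAt (fun x => a x + u x * u1 x) (a1 x + u1 x ^ 2 + u x * u2 x) x :=
    fun x => ((ha x).add ((hu x).mul (hu1 x))).congr_deriv (by ring)
  have hf1 : ∀ x, HasDerivAt (fun x => a1 x + u1 x ^ 2 + u x * u2 x)
      (a2 x + 3 * u1 x * u2 x + u x * u3 x) x :=
    fun x => (((ha1 x).add ((hu1 x).pow 2)).add ((hu x).mul (hu2 x))).congr_deriv (by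
      push_cast; ring)
  have hh : ∀ x, HasDerivAt (fun x => u1 x ^ 2 / 2) (u1 x * u2 x) x :=
    fun x => (((hu1 x).pow 2).div_const 2).congr_deriv (by push_cast; ring)
  have k1 := CHaux_max_abs _ _ (-1) (2 * U * V + V ^ 2 / 2)
    (fun x => ((hf x).add (hf1 x)).sub (hh x))
    (fun x => by simp [pu x, pu1 x, pu2 x, pa x, pa1 x]) (fun x => by
      have e := he x
      have := abs_le.1 (hb1 x)
      have := hb2 x
      have := sq_nonneg (u1 x)
      simp only [Pi.add_apply, Pi.sub_apply]
      rw [abs_le]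
      constructor <;> linarith) x
  have k2 := CHaux_max_abs _ _ 1 (2 * U * V + V ^ 2 / 2)
    (fun x => ((hf x).sub (hf1 x)).add (hh x))
    (fun x => by simp [pu x, pu1 x, pu2 x, pa x, pa1 x]) (fun x => by
      have e := he x
      have := abs_le.1 (hb1 x)
      have := hb2 x
      have := sq_nonneg (u1 x)
      simp only [Pi.add_apply, Pi.sub_apply]
      rw [abs_le]
      constructor <;> linarith) x
  simp only [Pi.add_apply, Pi.sub_apply] at k1 k2
  rw [abs_le] at k1 k2
  have := hb2 x
  have := sq_nonneg (u1 x)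
  rw [abs_le, abs_le]
  refine ⟨⟨?_, ?_⟩, ?_, ?_⟩ <;> linarith

lemma CHaux_first (T : ℝ) (M E E' : ℝ → ℝ) (hM : Continuous M)
    (hE : ∀ t, HasDerivAt E (E' t) t) (h0 : M 0 < E 0)
    (h : ∀ t ∈ Set.Ioc 0 T, M t = E t → ∃ (w : ℝ → ℝ) (D : ℝ), (∀ s, w s ≤ M s) ∧ w t = M t ∧
      HasDerivAt w D t ∧ D < E' t) : ∀ t ∈ Set.Icc 0 T, M t < E t := by
  have hEc : Continuous E := continuous_iff_continuousAt.2 fun x => (hE x).continuousAt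
  by_contra! hcon
  obtain ⟨t0, ht0, hl0⟩ := hcon
  have hK : IsCompact (Set.Icc 0 T ∩ {t | E t ≤ M t}) :=
    isCompact_Icc.inter_right (isClosed_le hEc hM)
  obtain ⟨t, ⟨htI, htE⟩, hmin⟩ := hK.exists_isLeast ⟨t0, ht0, hl0⟩
  have htE : E t ≤ M t := htE
  have htpos : 0 < t := by
    rcases htI.1.lt_or_eq with h | h
    · exact h
    · rw [← h] at htE; linarith
  have hlt : ∀ s ∈ Set.Ico 0 t, M s < E s := by
    intro s hs
    by_contra! hc
    exact absurd (hmin ⟨⟨hs.1, hs.2.le.trans htI.2⟩, hc⟩) (not_le.2 hs.2)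
  have hev : ∀ᶠ s in nhdsWithin t (Set.Iio t), M s < E s := by
    filter_upwards [Ico_mem_nhdsLT htpos] with s hs using hlt s hs
  have hle : M t ≤ E t := by
    refine le_of_tendsto_of_tendsto (hM.continuousAt.tendsto.mono_left nhdsWithin_le_nhds)
      (hEc.continuousAt.tendsto.mono_left nhdsWithin_le_nhds) (b := nhdsWithin t (Set.Iio t)) ?_
    filter_upwards [hev] with s hs using hs.le
  obtain ⟨w, D, hw, hwt, hD, hDE⟩ := h t ⟨htpos, htI.2⟩ (le_antisymm hle htE)
  have hd := (hE t).sub hD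
  have hs := hasDerivAt_iff_tendsto_slope.1 hd
  have hs2 := hs.mono_left (nhdsWithin_mono t (s := Set.Iio t) (fun x hx => ne_of_lt hx))
  have := hs2.eventually (lt_mem_nhds (show (0:ℝ) < E' t - D by linarith))
  obtain ⟨s, h1, h2, h3⟩ := (this.and (hev.and self_mem_nhdsWithin)).exists
  have h3 : s < t := h3
  rw [slope_def_field] at h1
  simp only [Pi.sub_apply] at h1
  have h4 := hw s
  have : (E s - w s - (E t - w t)) / (s - t) ≤ 0 :=
    div_nonpos_of_nonneg_of_nonpos (by linarith) (by linarith)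
  linarith

lemma CHaux_sup_cont (g : ℝ → ℝ → ℝ) (hg : Continuous (Function.uncurry g))
    (hp : ∀ t, Function.Periodic (g t) (2 * Real.pi)) : Continuous fun t => ⨆ x, |g t x| := by
  have hpi : (0:ℝ) < 2 * Real.pi := by positivity
  have e : (fun t => ⨆ x, |g t x|) =
      fun t => sSup ((fun x => |g t x|) '' Set.Icc 0 (0 + 2 * Real.pi)) := by
    funext t
    have : Function.Periodic (fun x => |g t x|) (2 * Real.pi) := fun x => by simp [hp t x]
    rw [this.image_Icc hpi]; rfl
  rw [e]
  exact isCompact_Icc.continuous_sSup (f := fun t x => |g t x|) hg.abs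

lemma CHaux_sup_attain (g : ℝ → ℝ) (hg : Continuous g)
    (hp : Function.Periodic g (2 * Real.pi)) : (∀ x, |g x| ≤ ⨆ y, |g y|) ∧
    ∃ x0 s : ℝ, |s| = 1 ∧ s * g x0 = (⨆ y, |g y|) ∧ ∀ g', HasDerivAt g g' x0 → g' = 0 := by
  obtain ⟨x0, h0⟩ := CHaux_attain (fun x => |g x|) hg.abs (fun x => by simp [hp x])
  have hb : BddAbove (Set.range fun x => |g x|) := ⟨|g x0|, by rintro _ ⟨x, rfl⟩; exact h0 x⟩
  have hs : (⨆ y, |g y|) = |g x0| := le_antisymm (ciSup_le h0) (le_ciSup hb x0)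
  refine ⟨fun x => le_ciSup hb x, x0, ?_⟩
  rw [hs]
  rcases le_total 0 (g x0) with h | h
  · refine ⟨1, by simp, by rw [abs_of_nonneg h, one_mul], fun g' hg' => ?_⟩
    have hl : IsLocalMax g x0 := Filter.Eventually.of_forall fun x => by
      have := h0 x
      simp only [abs_of_nonneg h] at this
      exact (le_abs_self _).trans this
    exact hl.hasDerivAt_eq_zero hg'
  · refine ⟨-1, by simp, by rw [abs_of_nonpos h]; ring, fun g' hg' => ?_⟩
    have hl : IsLocalMin g x0 := Filter.Eventually.of_forall fun x => by
      have := h0 x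
      simp only [abs_of_nonpos h] at this
      have := neg_abs_le (g x)
      linarith
    exact hl.hasDerivAt_eq_zero hg'

def CHdx (F : ℝ × ℝ → ℝ) (p : ℝ × ℝ) : ℝ := fderiv ℝ F p (0, 1)
def CHdt (F : ℝ × ℝ → ℝ) (p : ℝ × ℝ) : ℝ := fderiv ℝ F p (1, 0)

lemma CHdx_smooth {F : ℝ × ℝ → ℝ} (hF : ContDiff ℝ (⊤ : ℕ∞) F) :
    ContDiff ℝ (⊤ : ℕ∞) (CHdx F) :=
  (hF.fderiv_right (m := ((⊤ : ℕ∞) : WithTop ℕ∞)) (by simp)).clm_apply contDiff_const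

lemma CHdt_smooth {F : ℝ × ℝ → ℝ} (hF : ContDiff ℝ (⊤ : ℕ∞) F) :
    ContDiff ℝ (⊤ : ℕ∞) (CHdt F) :=
  (hF.fderiv_right (m := ((⊤ : ℕ∞) : WithTop ℕ∞)) (by simp)).clm_apply contDiff_const

lemma CHdx_has {F : ℝ × ℝ → ℝ} (hF : ContDiff ℝ (⊤ : ℕ∞) F) (t x : ℝ) :
    HasDerivAt (fun y => F (t, y)) (CHdx F (t, x)) x := by
  have h := (hF.differentiable (by simp) (t, x)).hasFDerivAt
  exact h.comp_hasDerivAt x ((hasDerivAt_const x t).prodMk (hasDerivAt_id x))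

lemma CHdt_has {F : ℝ × ℝ → ℝ} (hF : ContDiff ℝ (⊤ : ℕ∞) F) (t x : ℝ) :
    HasDerivAt (fun s => F (s, x)) (CHdt F (t, x)) t := by
  have h := (hF.differentiable (by simp) (t, x)).hasFDerivAt
  exact h.comp_hasDerivAt t ((hasDerivAt_id t).prodMk (hasDerivAt_const t x))

lemma CHdtdx {F : ℝ × ℝ → ℝ} (hF : ContDiff ℝ (⊤ : ℕ∞) F) : CHdt (CHdx F) = CHdx (CHdt F) := by
  funext p
  have hd : DifferentiableAt ℝ (fderiv ℝ F) p :=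
    (hF.fderiv_right (m := ((⊤ : ℕ∞) : WithTop ℕ∞)) (by simp)).differentiable (by simp) p
  have hs : IsSymmSndFDerivAt ℝ F p :=
    (hF.contDiffAt).isSymmSndFDerivAt (by
      simp only [minSmoothness_of_isRCLikeNormedField]; exact WithTop.coe_le_coe.2 (le_top : (2 : ℕ∞) ≤ ⊤))
  have e : ∀ v w : ℝ × ℝ, fderiv ℝ (fun q => fderiv ℝ F q v) p w = fderiv ℝ (fderiv ℝ F) p w v := by
    intro v w
    rw [fderiv_clm_apply hd (differentiableAt_const v)]
    simp
  change fderiv ℝ (fun q => fderiv ℝ F q (0, 1)) p (1, 0)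
    = fderiv ℝ (fun q => fderiv ℝ F q (1, 0)) p (0, 1)
  rw [e, e]
  exact hs _ _

lemma CHdx_per {F : ℝ × ℝ → ℝ} (hF : ContDiff ℝ (⊤ : ℕ∞) F)
    (hp : ∀ t, Function.Periodic (fun x => F (t, x)) (2 * Real.pi)) (t : ℝ) :
    Function.Periodic (fun x => CHdx F (t, x)) (2 * Real.pi) := by
  intro x
  have h1 := (CHdx_has hF t (x + 2 * Real.pi)).comp_add_const x (2 * Real.pi)
  have : (fun x => F (t, x + 2 * Real.pi)) = fun x => F (t, x) := funext (hp t)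
  rw [this] at h1
  exact h1.unique (CHdx_has hF t x)

lemma CHdt_per {F : ℝ × ℝ → ℝ} (hF : ContDiff ℝ (⊤ : ℕ∞) F)
    (hp : ∀ t, Function.Periodic (fun x => F (t, x)) (2 * Real.pi)) (t : ℝ) :
    Function.Periodic (fun x => CHdt F (t, x)) (2 * Real.pi) := by
  intro x
  have h1 := CHdt_has hF t (x + 2 * Real.pi)
  have : (fun s => F (s, x + 2 * Real.pi)) = fun s => F (s, x) := funext fun s => hp s x
  rw [this] at h1
  exact h1.unique (CHdt_has hF t x)

lemma CHaux_sgn {s a B : ℝ} (hs : |s| = 1) (h : |a| ≤ B) : s * a ≤ B := by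
  refine (le_abs_self _).trans ?_
  rw [abs_mul, hs, one_mul]; exact h

/-- A priori estimate for the periodic Camassa–Holm equation: there is `C̃ > 0` such that
`‖u(t)‖_{L^∞} + ‖∂_x u(t)‖_{L^∞} ≤ (‖u(0)‖_{L^∞} + ‖∂_x u(0)‖_{L^∞}) exp(C̃ ∫_0^t ‖∂_x u(τ)‖_{L^∞} dτ)`. -/
theorem CH_C01_estimate :
    ∃ C : ℝ, 0 < C ∧ ∀ T : ℝ, 0 < T → ∀ u : ℝ → ℝ → ℝ, IsCHSolution T u →
      ∀ t ∈ Set.Icc (0:ℝ) T,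
        (⨆ x : ℝ, |u t x|) + (⨆ x : ℝ, |deriv (u t) x|) ≤
          ((⨆ x : ℝ, |u 0 x|) + (⨆ x : ℝ, |deriv (u 0) x|)) *
            Real.exp (C * ∫ τ in (0:ℝ)..t, ⨆ x : ℝ, |deriv (u τ) x|) := by
  refine ⟨4, by norm_num, ?_⟩
  rintro T hT u ⟨hF, hper, heq⟩ t ht
  set F : ℝ × ℝ → ℝ := Function.uncurry u with hFdef
  have hF1 := CHdx_smooth hF
  have hF2 := CHdx_smooth hF1
  have hA := CHdt_smooth hF
  have hA1 := CHdx_smooth hA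
  have pF : ∀ t, Function.Periodic (fun x => F (t, x)) (2 * Real.pi) := hper
  have pF1 := CHdx_per hF pF
  have pF2 := CHdx_per hF1 pF1
  have pA := CHdt_per hF pF
  have pA1 := CHdx_per hA pA
  have d1 : ∀ s, deriv (u s) = fun x => CHdx F (s, x) := fun s =>
    funext fun x => (CHdx_has hF s x).deriv
  have d2 : ∀ s, deriv (fun x => CHdx F (s, x)) = fun x => CHdx (CHdx F) (s, x) := fun s =>
    funext fun x => (CHdx_has hF1 s x).deriv
  have d3 : ∀ s, deriv (fun x => CHdx (CHdx F) (s, x)) = fun x => CHdx (CHdx (CHdx F)) (s, x) :=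
    fun s => funext fun x => (CHdx_has hF2 s x).deriv
  have e1 : ∀ s x, deriv (fun s => u s x) s = CHdt F (s, x) := fun s x => (CHdt_has hF s x).deriv
  have e2 : ∀ s x, deriv (fun s => CHdx (CHdx F) (s, x)) s = CHdx (CHdx (CHdt F)) (s, x) :=
    fun s x => by rw [(CHdt_has hF2 s x).deriv, CHdtdx hF1, CHdtdx hF]
  simp only [d1, d2, d3, e1, e2] at heq
  simp only [d1]
  set V : ℝ → ℝ := fun t => ⨆ x, |CHdx F (t, x)| with hV
  set U : ℝ → ℝ := fun t => ⨆ x, |u t x| with hU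
  have cV : Continuous V := CHaux_sup_cont (fun t x => CHdx F (t, x)) hF1.continuous pF1
  have cU : Continuous U := CHaux_sup_cont u hF.continuous hper
  have aU := fun t => CHaux_sup_attain (u t)
    (hF.continuous.comp (by fun_prop : Continuous fun x : ℝ => (t, x))) (hper t)
  have aV := fun t => CHaux_sup_attain (fun x => CHdx F (t, x))
    (hF1.continuous.comp (by fun_prop : Continuous fun x : ℝ => (t, x))) (pF1 t)
  have V0 : ∀ t, 0 ≤ V t := fun t => (abs_nonneg _).trans ((aV t).1 0)
  have U0 : ∀ t, 0 ≤ U t := fun t => (abs_nonneg _).trans ((aU t).1 0)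
  change U t + V t ≤ (U 0 + V 0) * Real.exp (4 * ∫ τ in (0:ℝ)..t, V τ)
  have main : ∀ ε : ℝ, 0 < ε → U t + V t ≤
      (U 0 + V 0 + ε) * Real.exp (4 * (∫ τ in (0:ℝ)..t, V τ) + ε * t) := by
    intro ε hε
    refine (CHaux_first T (fun t => U t + V t)
      (fun t => (U 0 + V 0 + ε) * Real.exp (4 * (∫ τ in (0:ℝ)..t, V τ) + ε * t))
      (fun t => (U 0 + V 0 + ε) * (Real.exp (4 * (∫ τ in (0:ℝ)..t, V τ) + ε * t) *
        (4 * V t + ε))) (cU.add cV) ?_ ?_ ?_ t ht).le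
    · intro t
      have h1 := (cV.integral_hasStrictDerivAt 0 t).hasDerivAt
      have h2 := ((h1.const_mul 4).add ((hasDerivAt_id t).const_mul ε)).exp.const_mul (U 0 + V 0 + ε)
      simpa using h2
    · simp [hε]
    · intro t ht he
      obtain ⟨x0, s1, hs1, hx0, hx0'⟩ := (aU t).2
      obtain ⟨y0, s2, hs2, hy0, hy0'⟩ := (aV t).2
      have hz1 := hx0' _ (CHdx_has hF t x0)
      have hz2 := hy0' _ (CHdx_has hF1 t y0)
      have key := CHaux_key (u t) (fun x => CHdx F (t, x)) (fun x => CHdx (CHdx F) (t, x))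
        (fun x => CHdx (CHdx (CHdx F)) (t, x)) (fun x => CHdt F (t, x))
        (fun x => CHdx (CHdt F) (t, x)) (fun x => CHdx (CHdx (CHdt F)) (t, x)) (U t) (V t)
        (CHdx_has hF t) (CHdx_has hF1 t) (CHdx_has hF2 t) (CHdx_has hA t) (CHdx_has hA1 t)
        (hper t) (pF1 t) (pF2 t) (pA t) (pA1 t) (heq t ⟨ht.1.le, ht.2⟩) (aU t).1 (aV t).1
      have k1 := (key x0).1
      have k2 := (key y0).2
      simp only [hz1, hz2, mul_zero, add_zero] at k1 k2
      refine ⟨fun s => s1 * F (s, x0) + s2 * CHdx F (s, y0),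
        s1 * CHdt F (t, x0) + s2 * CHdt (CHdx F) (t, y0), fun s => ?_, ?_, ?_, ?_⟩
      · exact add_le_add (CHaux_sgn hs1 ((aU s).1 x0)) (CHaux_sgn hs2 ((aV s).1 y0))
      · exact congrArg₂ (· + ·) hx0 hy0
      · exact ((CHdt_has hF t x0).const_mul s1).add ((CHdt_has hF1 t y0).const_mul s2)
      · rw [CHdtdx hF]
        have j1 := CHaux_sgn hs1 k1
        have hsq : CHdx F (t, y0) ^ 2 ≤ V t ^ 2 := by
          rw [← sq_abs]; exact pow_le_pow_left₀ (abs_nonneg _) ((aV t).1 y0) 2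
        have k3 : |CHdx (CHdt F) (t, y0)| ≤ V t * (2 * U t + V t) + V t ^ 2 := by
          have := sq_nonneg (CHdx F (t, y0))
          rw [abs_le] at k2 ⊢
          constructor <;> linarith [k2.1, k2.2, sq_nonneg (V t)]
        have j2 := CHaux_sgn hs2 k3
        have hpos : 0 < U t + V t := by
          rw [he]
          have := U0 0
          have := V0 0
          positivity
        rw [← mul_assoc, ← he]
        have := mul_pos hpos hε
        nlinarith [sq_nonneg (V t)]
  have hlim : Tendsto (fun ε : ℝ => (U 0 + V 0 + ε) *
      Real.exp (4 * (∫ τ in (0:ℝ)..t, V τ) + ε * t)) (nhdsWithin 0 (Set.Ioi 0))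
      (nhds ((U 0 + V 0 + 0) * Real.exp (4 * (∫ τ in (0:ℝ)..t, V τ) + 0 * t))) := by
    refine Tendsto.mono_left (Continuous.tendsto ?_ 0) nhdsWithin_le_nhds
    fun_prop
  have := ge_of_tendsto hlim (by
    filter_upwards [self_mem_nhdsWithin] with ε hε using main ε hε)
  simpa using this
end
end
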